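/- arXiv:1407.0832 — 9 statements merged into one kernel-verified Lean document; each statement's English description precedes it below -/
import Mathlib

section
/- Let α ∈ ℚ_p. Then α is rational if and only if either its Ruban continued fraction expansion is finite (i.e. α_n = ⌊α_n⌋_p for some n), or its expansion is infinite and its partial quotients are ultimately periodic with period p − p^{−1}, i.e. there exists N such that a_n = p − p^{−1} for all n ≥ N. -/
open Filter

/-- `S_p`: rationals `b` with `b·p^k ∈ ℤ` for some `k ≥ 0` and `0 ≤ b < p`. -/
def Sp (p : ℕ) : Set ℚ :=
  {b : ℚ | (∃ k : ℕ, ∃ z : ℤ, (z : ℚ) = b * (p : ℚ) ^ k) ∧ 0 ≤ b ∧ b < (p : ℚ)}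

/-- A sequence is ultimately periodic if `a_{n+l} = a_n` for all `n ≥ k`,
for some `k ≥ 0`, `l ≥ 1`. -/
def UltimatelyPeriodic (a : ℕ → ℚ) : Prop :=
  ∃ k l : ℕ, 1 ≤ l ∧ ∀ n, k ≤ n → a (n + l) = a n

/-- Dependent choice for a sequence of states `s n` satisfying `P n (s n)`. -/
theorem exists_seq_of_step {σ : Type*} {P : ℕ → σ → Prop} {R : ℕ → σ → σ → Prop}
    (h₀ : ∃ s, P 0 s) (hstep : ∀ n s, P n s → ∃ s', P (n + 1) s' ∧ R n s s') :
    ∃ f : ℕ → σ, (∀ n, P n (f n)) ∧ ∀ n, R n (f n) (f (n + 1)) := by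
  choose g hgP hgR using hstep
  obtain ⟨s₀, hs₀⟩ := h₀
  let F : ∀ n, {s // P n s} := fun n =>
    Nat.rec ⟨s₀, hs₀⟩ (fun n s => ⟨g n s.1 s.2, hgP n s.1 s.2⟩) n
  exact ⟨fun n => (F n).1, fun n => (F n).2, fun n => hgR n (F n).1 (F n).2⟩

/-- An integer sequence obtained from division steps with remainders divisible by high powers
of `p` eventually has constant absolute value, which determines its digits `c`. -/
theorem eventually_digit_eq {p : ℕ} (hp : 2 ≤ p) {D c : ℕ → ℤ} {k : ℕ → ℕ}
    (hD : ∀ n, D (n + 1) ≠ 0) (hk : ∀ n, 1 ≤ k (n + 1)) (hc : ∀ n, 0 ≤ c n)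
    (hcp : ∀ n, c n < (p : ℤ) ^ (k n + 1))
    (hrec : ∀ n, D (n + 2) * (p : ℤ) ^ (k n + k (n + 1)) = D n - c n * D (n + 1)) :
    ∃ N, ∀ n, N ≤ n → k n = 1 ∧ c n = (p : ℤ) ^ 2 - 1 := by
  have hp' : (1 : ℤ) < p := by exact_mod_cast hp
  have hpow (n : ℕ) : (2 : ℤ) ≤ (p : ℤ) ^ (k n + 1) :=
    one_lt_pow₀ hp' (Nat.succ_ne_zero (k n))
  have hQ (n : ℕ) : (1 : ℤ) ≤ (p : ℤ) ^ (k (n + 1) - 1) := one_le_pow₀ hp'.le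
  have hbound (n : ℕ) : |D (n + 2)| * ((p : ℤ) ^ (k n + 1) * (p : ℤ) ^ (k (n + 1) - 1)) ≤
      |D n| + c n * |D (n + 1)| := by
    have h1 : (p : ℤ) ^ (k n + 1) * (p : ℤ) ^ (k (n + 1) - 1) =
        (p : ℤ) ^ (k n + k (n + 1)) := by
      rw [← pow_add]; congr 1; have := hk n; omega
    rw [h1, ← abs_of_nonneg (show (0 : ℤ) ≤ (p : ℤ) ^ (k n + k (n + 1)) by positivity),
      ← abs_mul, hrec]
    refine (abs_sub _ _).trans ?_
    rw [abs_mul, abs_of_nonneg (hc n)]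
  have hbound' (n : ℕ) : |D (n + 2)| * (p : ℤ) ^ (k n + 1) ≤
      |D n| + ((p : ℤ) ^ (k n + 1) - 1) * |D (n + 1)| := by
    have h1 : |D (n + 2)| * (p : ℤ) ^ (k n + 1) ≤
        |D (n + 2)| * ((p : ℤ) ^ (k n + 1) * (p : ℤ) ^ (k (n + 1) - 1)) := by
      rw [← mul_assoc]
      exact le_mul_of_one_le_right (mul_nonneg (abs_nonneg _) (by linarith [hpow n])) (hQ n)
    have h2 : c n * |D (n + 1)| ≤ ((p : ℤ) ^ (k n + 1) - 1) * |D (n + 1)| :=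
      mul_le_mul_of_nonneg_right (by linarith [Int.add_one_le_iff.mpr (hcp n)]) (abs_nonneg _)
    linarith [hbound n]
  have hle (n : ℕ) (M : ℤ) (h0 : |D n| ≤ M) (h1 : |D (n + 1)| ≤ M) : |D (n + 2)| ≤ M := by
    nlinarith [hbound' n, hpow n]
  have hlt (n : ℕ) (M : ℤ) (h0 : |D n| ≤ M) (h1 : |D (n + 1)| ≤ M)
      (h : |D n| < M ∨ |D (n + 1)| < M) : |D (n + 2)| < M := by
    by_contra! hcon
    rcases h with h | h <;> nlinarith [hbound' n, hpow n]
  let m : ℕ → ℕ := fun n => max (D n).natAbs (D (n + 1)).natAbs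
  obtain ⟨N, hN⟩ : ∃ N, ∀ n, m N ≤ m n :=
    ⟨Function.argmin m, fun n => Function.argmin_le m n⟩
  have hupper (j : ℕ) : |D (N + j)| ≤ m N ∧ |D (N + j + 1)| ≤ m N := by
    induction j with
    | zero =>
      simp only [m, Nat.add_zero, Nat.cast_max, Int.natCast_natAbs]
      exact ⟨le_max_left _ _, le_max_right _ _⟩
    | succ j ih => exact ⟨ih.2, hle _ _ ih.1 ih.2⟩
  have hconst (j : ℕ) : |D (N + j)| = m N := by
    refine le_antisymm (hupper j).1 (not_lt.mp fun h => ?_)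
    have h2 := hlt _ _ (hupper j).1 (hupper j).2 (.inl h)
    have h3 := hlt _ _ (hupper (j + 1)).1 (hupper (j + 1)).2 (.inr h2)
    have h4 : (m N : ℤ) ≤ m (N + j + 2) := by exact_mod_cast hN (N + j + 2)
    refine h4.not_gt ?_
    rw [show m (N + j + 2) = max (D (N + j + 2)).natAbs (D (N + j + 3)).natAbs from rfl,
      Nat.cast_max, Int.natCast_natAbs, Int.natCast_natAbs]
    exact max_lt h2 h3
  have hM : (0 : ℤ) < m N := by
    rw [← hconst 1]; exact abs_pos.mpr (hD N)
  have heq (j : ℕ) : k (N + j + 1) = 1 ∧ c (N + j) = (p : ℤ) ^ (k (N + j) + 1) - 1 := by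
    have h := hbound (N + j)
    have e2 := hconst (j + 2)
    have e1 := hconst (j + 1)
    rw [← Nat.add_assoc] at e1 e2
    rw [hconst j, e1, e2] at h
    have h' : (p : ℤ) ^ (k (N + j) + 1) * (p : ℤ) ^ (k (N + j + 1) - 1) ≤ 1 + c (N + j) := by
      refine le_of_mul_le_mul_left ?_ hM
      linarith
    have hcp' := hcp (N + j)
    have hP := hpow (N + j)
    have hQ' := hQ (N + j)
    have hQ1 : (p : ℤ) ^ (k (N + j + 1) - 1) = 1 := by nlinarith
    refine ⟨?_, ?_⟩
    · by_contra hne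
      have hk1 := hk (N + j)
      exact (one_lt_pow₀ hp' (show k (N + j + 1) - 1 ≠ 0 by omega)).ne' hQ1
    · rw [hQ1] at h'; linarith
  refine ⟨N + 1, fun n hn => ?_⟩
  obtain ⟨j, rfl⟩ := Nat.exists_eq_add_of_le hn
  have h1 := (heq j).1
  have h2 := (heq (j + 1)).2
  rw [show N + j + 1 = N + 1 + j by omega] at h1
  rw [show N + (j + 1) = N + 1 + j by omega, h1] at h2
  exact ⟨h1, h2⟩

/-- A rational in `ℤ[1/p]` which is `p`-adically integral is an integer. -/
theorem exists_int_eq_of_padicNorm_le_one {p : ℕ} [Fact p.Prime] {q : ℚ} {j : ℕ} {z : ℤ}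
    (hz : (z : ℚ) = q * (p : ℚ) ^ j) (hq : ‖(q : ℚ_[p])‖ ≤ 1) : ∃ c : ℤ, q = c := by
  have hp0 : (p : ℚ) ≠ 0 := by exact_mod_cast (Fact.out : p.Prime).ne_zero
  have hz' : (z : ℚ_[p]) = (q : ℚ_[p]) * (p : ℚ_[p]) ^ j := by exact_mod_cast congrArg (fun t : ℚ => (t : ℚ_[p])) hz
  have hdvd : (p : ℤ) ^ j ∣ z := by
    rw [← Padic.norm_int_le_pow_iff_dvd, hz', norm_mul, Padic.norm_p_pow]
    exact mul_le_of_le_one_left (by positivity) hq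
  obtain ⟨c, rfl⟩ := hdvd
  refine ⟨c, mul_right_cancel₀ (pow_ne_zero j hp0) ?_⟩
  rw [← hz]; push_cast; ring

/-- One step of the Ruban algorithm on a rational `u / (v p ^ k)`, in terms of integers. -/
theorem ruban_step {p : ℕ} [Fact p.Prime] {x : ℚ_[p]} {a : ℚ} (ha : a ∈ Sp p)
    (hxa : ‖x - (a : ℚ_[p])‖ ≤ (p : ℝ)⁻¹) (hne : x ≠ a) {u v : ℤ} {k : ℕ}
    (hv : ¬ (p : ℤ) ∣ v) (hx : x = u / (v * (p : ℚ_[p]) ^ k)) :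
    ∃ (c v' : ℤ) (k' : ℕ), 1 ≤ k' ∧ ¬ (p : ℤ) ∣ v' ∧ a = c / (p : ℚ) ^ k ∧ 0 ≤ c ∧
      c < (p : ℤ) ^ (k + 1) ∧ v' * (p : ℤ) ^ (k + k') = u - c * v ∧
      (x - (a : ℚ_[p]))⁻¹ = v / (v' * (p : ℚ_[p]) ^ k') := by
  have hpp : p.Prime := Fact.out
  have hp0 : (p : ℚ) ≠ 0 := by exact_mod_cast hpp.ne_zero
  have hp0' : (p : ℚ_[p]) ≠ 0 := by exact_mod_cast hpp.ne_zero
  have hpR : (1 : ℝ) < p := by exact_mod_cast hpp.one_lt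
  have hv0 : (v : ℚ_[p]) ≠ 0 := by
    have : v ≠ 0 := by rintro rfl; exact hv (dvd_zero _)
    exact_mod_cast this
  have hvn : ‖(v : ℚ_[p])‖ = 1 :=
    le_antisymm (Padic.norm_int_le_one v)
      (not_lt.mp fun h => hv (Padic.norm_intCast_lt_one_iff.mp h))
  obtain ⟨⟨j, z, hz⟩, ha0, hap⟩ := ha
  have hint : ‖((a * (p : ℚ) ^ k : ℚ) : ℚ_[p])‖ ≤ 1 := by
    have h1 : ((a * (p : ℚ) ^ k : ℚ) : ℚ_[p]) =
        x * (p : ℚ_[p]) ^ k - (x - a) * (p : ℚ_[p]) ^ k := by push_cast; ring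
    rw [h1, sub_eq_add_neg]
    refine (Padic.nonarchimedean _ _).trans (max_le ?_ ?_)
    · rw [hx, div_mul_eq_mul_div, mul_div_mul_right _ _ (pow_ne_zero k hp0'), norm_div, hvn,
        div_one]
      exact Padic.norm_int_le_one u
    · rw [norm_neg, norm_mul]
      refine mul_le_one₀ (hxa.trans (inv_le_one_of_one_le₀ hpR.le)) (norm_nonneg _) ?_
      rw [norm_pow]
      exact pow_le_one₀ (norm_nonneg _) Padic.norm_p_lt_one.le
  obtain ⟨c, hc⟩ := exists_int_eq_of_padicNorm_le_one (z := z * p ^ k) (j := j)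
    (by push_cast; rw [hz]; ring) hint
  have hac : a = c / (p : ℚ) ^ k := by rw [← hc]; field_simp
  have hacp : (a : ℚ_[p]) = c / (p : ℚ_[p]) ^ k := by rw [hac]; push_cast; rfl
  have hsub : ((u - c * v : ℤ) : ℚ_[p]) = (x - a) * (v * (p : ℚ_[p]) ^ k) := by
    rw [hx, hacp]; push_cast; field_simp
  have hne' : u - c * v ≠ 0 := by
    intro h
    rw [h, Int.cast_zero, eq_comm] at hsub
    exact mul_ne_zero (sub_ne_zero.mpr hne) (mul_ne_zero hv0 (pow_ne_zero k hp0')) hsub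
  have hdvd : (p : ℤ) ^ (k + 1) ∣ u - c * v := by
    rw [← Padic.norm_int_le_pow_iff_dvd, hsub, norm_mul, norm_mul, hvn, one_mul,
      Padic.norm_p_pow]
    calc ‖x - (a : ℚ_[p])‖ * (p : ℝ) ^ (-(k : ℤ)) ≤ (p : ℝ)⁻¹ * (p : ℝ) ^ (-(k : ℤ)) := by gcongr
      _ = (p : ℝ) ^ (-((k + 1 : ℕ) : ℤ)) := by
        rw [← zpow_neg_one, ← zpow_add₀ (by positivity)]; congr 1; push_cast; ring
  obtain ⟨w, hw⟩ := hdvd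
  have hw0 : w ≠ 0 := by rintro rfl; exact hne' (by simpa using hw)
  obtain ⟨v', hv', hpv'⟩ := (Int.finiteMultiplicity_iff.mpr
    ⟨by simpa using hpp.ne_one, hw0⟩ : FiniteMultiplicity (p : ℤ) w).exists_eq_pow_mul_and_not_dvd
  generalize multiplicity (p : ℤ) w = i at hv'
  have hv'0 : (v' : ℚ_[p]) ≠ 0 := by
    have : v' ≠ 0 := by rintro rfl; exact hpv' (dvd_zero _)
    exact_mod_cast this
  have hrec : v' * (p : ℤ) ^ (k + (i + 1)) = u - c * v := by rw [hw, hv']; ring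
  refine ⟨c, v', i + 1, Nat.le_add_left _ _, hpv', hac, ?_, ?_, hrec, ?_⟩
  · have : (0 : ℚ) ≤ c := by rw [← hc]; positivity
    exact_mod_cast this
  · have : (c : ℚ) < (p : ℚ) ^ (k + 1) := by
      rw [← hc, pow_succ']
      exact mul_lt_mul_of_pos_right hap (pow_pos (by exact_mod_cast hpp.pos) k)
    exact_mod_cast this
  · have h : (x - a) * (v * (p : ℚ_[p]) ^ k) = v' * (p : ℚ_[p]) ^ (k + (i + 1)) := by
      rw [← hsub, ← hrec]; push_cast; rfl
    have hxa0 : x - (a : ℚ_[p]) ≠ 0 := sub_ne_zero.mpr hne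
    rw [inv_eq_one_div, div_eq_div_iff hxa0 (mul_ne_zero hv'0 (pow_ne_zero _ hp0')), one_mul]
    refine mul_right_cancel₀ (pow_ne_zero k hp0') ?_
    linear_combination -h

/-- A rational number has the form `u / (v p ^ k)` with `k ≥ 0` and `v` coprime to `p`. -/
theorem exists_rat_eq_div_mul_pow {p : ℕ} (hp : p.Prime) (b : ℚ) :
    ∃ (u v : ℤ) (k : ℕ), ¬ (p : ℤ) ∣ v ∧ b = u / (v * (p : ℚ) ^ k) := by
  obtain ⟨k, v, hv, hb⟩ := Nat.exists_eq_pow_mul_and_not_dvd b.den_nz p hp.ne_one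
  refine ⟨b.num, v, k, fun h => hv (Int.natCast_dvd_natCast.mp h), ?_⟩
  conv_lhs => rw [← Rat.num_div_den b, hb]
  push_cast
  rw [mul_comm]

/-- If all later partial quotients equal `p - p⁻¹`, the complete quotient is `-p⁻¹`. -/
theorem eq_neg_inv_of_forall_floor_eq {p : ℕ} [Fact p.Prime] {x : ℕ → ℚ_[p]}
    (hne : ∀ n, x n - (p - (p : ℚ_[p])⁻¹) ≠ 0)
    (hle : ∀ n, ‖x n - (p - (p : ℚ_[p])⁻¹)‖ ≤ (p : ℝ)⁻¹)
    (hx : ∀ n, x (n + 1) = (x n - (p - (p : ℚ_[p])⁻¹))⁻¹) : x 0 = -(p : ℚ_[p])⁻¹ := by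
  have hpp : p.Prime := Fact.out
  have hp0 : (p : ℚ_[p]) ≠ 0 := by exact_mod_cast hpp.ne_zero
  have hpR : (1 : ℝ) < p := by exact_mod_cast hpp.one_lt
  have hy (n : ℕ) : x n + (p : ℚ_[p])⁻¹ =
      (x (n + 1) + (p : ℚ_[p])⁻¹) * (p * (x n - (p - (p : ℚ_[p])⁻¹))) := by
    rw [hx]
    have hne_n := hne n
    rw [show x n + (p : ℚ_[p])⁻¹ = (x n - (p - (p : ℚ_[p])⁻¹)) + p by ring]
    generalize x n - (p - (p : ℚ_[p])⁻¹) = y at hne_n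
    field_simp
    ring
  have hy1 (n : ℕ) : ‖x n + (p : ℚ_[p])⁻¹‖ ≤ 1 := by
    rw [show x n + (p : ℚ_[p])⁻¹ = (x n - (p - (p : ℚ_[p])⁻¹)) + p by ring]
    refine (Padic.nonarchimedean _ _).trans (max_le ?_ Padic.norm_p_lt_one.le)
    exact (hle n).trans (inv_le_one_of_one_le₀ hpR.le)
  have hdecay (j : ℕ) : ∀ n, ‖x n + (p : ℚ_[p])⁻¹‖ ≤ ((p : ℝ)⁻¹) ^ j := by
    induction j with
    | zero => simpa using hy1
    | succ j ih =>
      intro n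
      rw [hy n, norm_mul, norm_mul, Padic.norm_p, pow_succ]
      gcongr
      · exact ih (n + 1)
      · exact mul_le_of_le_one_right (by positivity)
          ((hle n).trans (inv_le_one_of_one_le₀ hpR.le))
  have hlim := tendsto_pow_atTop_nhds_zero_of_lt_one (inv_nonneg.mpr (zero_le_one.trans hpR.le))
    (inv_lt_one_of_one_lt₀ hpR)
  have h0 := ge_of_tendsto' hlim fun j => hdecay j 0
  exact eq_neg_of_add_eq_zero_left (norm_le_zero_iff.mp h0)

/-- **Proposition 1.** A `p`-adic number is rational iff its Ruban continued fraction
expansion is finite, or is infinite and ultimately periodic with period `p - p⁻¹`.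
Here `pfloor` is the `p`-adic floor function (the unique element `b` of `S_p` with
`|x - b|_p ≤ 1/p`), and `αseq` is the sequence of complete quotients of `α`, which
satisfies the Ruban algorithm step whenever it has not terminated. -/
theorem ruban_rational_iff
    (p : ℕ) [Fact p.Prime] (α : ℚ_[p])
    (pfloor : ℚ_[p] → ℚ)
    (hfloor : ∀ x : ℚ_[p], pfloor x ∈ Sp p ∧ ‖x - (pfloor x : ℚ_[p])‖ ≤ (p : ℝ)⁻¹)
    (αseq : ℕ → ℚ_[p]) (h0 : αseq 0 = α)
    (hstep : ∀ n, αseq n ≠ (pfloor (αseq n) : ℚ_[p]) →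
      αseq (n + 1) = (αseq n - (pfloor (αseq n) : ℚ_[p]))⁻¹) :
    (∃ b : ℚ, (b : ℚ_[p]) = α) ↔
      ((∃ n, αseq n = (pfloor (αseq n) : ℚ_[p])) ∨
        ((∀ n, αseq n ≠ (pfloor (αseq n) : ℚ_[p])) ∧
          ∃ N, ∀ n, N ≤ n → pfloor (αseq n) = (p : ℚ) - (p : ℚ)⁻¹)) := by
  have hpp : p.Prime := Fact.out
  have hp0 : (p : ℚ) ≠ 0 := by exact_mod_cast hpp.ne_zero
  constructor
  · rintro ⟨b, hb⟩
    by_cases hfin : ∃ n, αseq n = (pfloor (αseq n) : ℚ_[p])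
    · exact .inl hfin
    push Not at hfin
    refine .inr ⟨hfin, ?_⟩
    obtain ⟨u₀, v₀, k₀, hv₀, hb₀⟩ := exists_rat_eq_div_mul_pow hpp b
    obtain ⟨f, hfP, hfR⟩ := exists_seq_of_step (σ := ℤ × ℤ × ℕ)
      (P := fun n s => ¬ (p : ℤ) ∣ s.2.1 ∧
        αseq n = s.1 / (s.2.1 * (p : ℚ_[p]) ^ s.2.2))
      (R := fun n s t => t.1 = s.2.1 ∧ 1 ≤ t.2.2 ∧
        ∃ c : ℤ, pfloor (αseq n) = c / (p : ℚ) ^ s.2.2 ∧ 0 ≤ c ∧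
          c < (p : ℤ) ^ (s.2.2 + 1) ∧ t.2.1 * (p : ℤ) ^ (s.2.2 + t.2.2) = s.1 - c * s.2.1)
      ⟨(u₀, v₀, k₀), hv₀, by rw [h0, ← hb, hb₀]; push_cast; rfl⟩
      (by
        rintro n ⟨u, v, k⟩ ⟨hv, hx⟩
        obtain ⟨c, v', k', hk', hv', hac, hc0, hcp, hrec, hinv⟩ :=
          ruban_step (hfloor (αseq n)).1 (hfloor (αseq n)).2 (hfin n) hv hx
        exact ⟨(v, v', k'), ⟨hv', by rw [hstep n (hfin n), hinv]⟩, rfl, hk', c, hac, hc0, hcp,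
          hrec⟩)
    choose hf1 hf2 c hac hc0 hcp hrec using hfR
    obtain ⟨N, hN⟩ := eventually_digit_eq hpp.two_le (D := fun n => (f n).1) (c := c)
      (k := fun n => (f n).2.2)
      (fun n h => (hfP n).1 (by rw [← hf1 n, h]; exact dvd_zero _)) hf2 hc0 hcp
      (fun n => by rw [hf1 (n + 1), hrec n, hf1 n])
    refine ⟨N, fun n hn => ?_⟩
    obtain ⟨hk, hc⟩ := hN n hn
    rw [hac n, hk, hc]
    push_cast
    field_simp
  · have hback (n : ℕ) : (∃ b : ℚ, (b : ℚ_[p]) = αseq n) → ∃ b : ℚ, (b : ℚ_[p]) = α := by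
      induction n with
      | zero => rw [h0]; exact id
      | succ n ih =>
        rintro ⟨b, hb⟩
        refine ih ?_
        by_cases h : αseq n = (pfloor (αseq n) : ℚ_[p])
        · exact ⟨_, h.symm⟩
        · refine ⟨b⁻¹ + pfloor (αseq n), ?_⟩
          push_cast
          rw [hb, hstep n h, inv_inv, sub_add_cancel]
    rintro (⟨n, hn⟩ | ⟨hinf, N, hN⟩)
    · exact hback n ⟨_, hn.symm⟩
    · have hfl (n : ℕ) : (pfloor (αseq (N + n)) : ℚ_[p]) = p - (p : ℚ_[p])⁻¹ := by
        rw [hN _ (Nat.le_add_right N n)]; push_cast; rfl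
      have hx := eq_neg_inv_of_forall_floor_eq (p := p) (x := fun n => αseq (N + n))
        (fun n => by rw [← hfl n]; exact sub_ne_zero.mpr (hinf _))
        (fun n => by rw [← hfl n]; exact (hfloor _).2)
        (fun n => by rw [← hfl n]; exact hstep _ (hinf _))
      exact hback N ⟨-(p : ℚ)⁻¹, by push_cast; exact hx.symm⟩
end

section
/- Let D be an integer that is not a perfect square and let α ∈ ℚ_p satisfy α² = D, with partial quotients (a_n) and associated rationals R_n, Q_n. If there exists m such that R_m·Q_m ≤ 0 and R_{m+1}² > D, then the sequence (a_n) of partial quotients of α is not ultimately periodic (i.e. there are no integers k ≥ 0 and l ≥ 1 with a_{n+l} = a_n for all n ≥ k). -/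
open Filter

/-- Two `p`-adic continued fractions with the same partial quotients and all remainders of norm
at most `p⁻¹` have the same value. -/
theorem Padic.eq_of_same_partial_quotients {p : ℕ} [Fact p.Prime] {x y b : ℕ → ℚ_[p]}
    (hx : ∀ n, ‖x n - b n‖ ≤ (p : ℝ)⁻¹) (hy : ∀ n, ‖y n - b n‖ ≤ (p : ℝ)⁻¹)
    (hxb : ∀ n, x n ≠ b n) (hyb : ∀ n, y n ≠ b n)
    (hxs : ∀ n, x (n + 1) = (x n - b n)⁻¹) (hys : ∀ n, y (n + 1) = (y n - b n)⁻¹) :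
    x 0 = y 0 := by
  have hp : (1 : ℝ) < p := by exact_mod_cast (Fact.out : p.Prime).one_lt
  have hp0 : (0 : ℝ) ≤ (p : ℝ)⁻¹ := by positivity
  have hp1 : (p : ℝ)⁻¹ < 1 := inv_lt_one_of_one_lt₀ hp
  have hdiff (n : ℕ) : x n - y n = -((x n - b n) * (y n - b n) * (x (n + 1) - y (n + 1))) := by
    have h1 := sub_ne_zero.2 (hxb n)
    have h2 := sub_ne_zero.2 (hyb n)
    rw [hxs, hys]
    field_simp
    ring
  have hbound (j : ℕ) : ∀ n, ‖x n - y n‖ ≤ 2 * (p : ℝ)⁻¹ ^ j := by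
    induction j with
    | zero =>
      intro n
      calc ‖x n - y n‖ = ‖(x n - b n) - (y n - b n)‖ := by congr 1; ring
        _ ≤ ‖x n - b n‖ + ‖y n - b n‖ := norm_sub_le _ _
        _ ≤ 2 * (p : ℝ)⁻¹ ^ 0 := by linarith [hx n, hy n]
    | succ j ih =>
      intro n
      rw [hdiff n, norm_neg, norm_mul, norm_mul]
      calc ‖x n - b n‖ * ‖y n - b n‖ * ‖x (n + 1) - y (n + 1)‖
          ≤ (p : ℝ)⁻¹ * 1 * (2 * (p : ℝ)⁻¹ ^ j) := by
            gcongr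
            · exact hx n
            · exact (hy n).trans hp1.le
            · exact ih (n + 1)
        _ = 2 * (p : ℝ)⁻¹ ^ (j + 1) := by ring
  have hlim : Tendsto (fun j : ℕ => 2 * (p : ℝ)⁻¹ ^ j) atTop (nhds 0) := by
    simpa using (tendsto_pow_atTop_nhds_zero_of_lt_one hp0 hp1).const_mul 2
  have hle : ‖x 0 - y 0‖ ≤ 0 := ge_of_tendsto' hlim fun j => hbound j 0
  exact sub_eq_zero.1 (norm_le_zero_iff.1 hle)

/-- A square root in `ℚ_[p]` of an integer which is not a perfect square is irrational. -/
theorem Padic.ne_ratCast_of_sq_eq_intCast {p : ℕ} [Fact p.Prime] {D : ℤ}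
    (hD : ¬ ∃ z : ℤ, z ^ 2 = D) {α : ℚ_[p]} (hα : α ^ 2 = (D : ℚ_[p])) (q : ℚ) :
    α ≠ (q : ℚ_[p]) := by
  rintro rfl
  have hq : q ^ 2 = (D : ℚ) := by exact_mod_cast hα
  have hsq : IsSquare (D : ℚ) := ⟨q, by rw [← hq, sq]⟩
  obtain ⟨z, hz⟩ := Rat.isSquare_intCast_iff.1 hsq
  exact hD ⟨z, by rw [hz, sq]⟩

/-- The `n`-th complete quotient of `α = √D` is `(α + R n) / Q n`. -/
theorem mul_completeQuotient_eq {K : Type*} [Field K] [CharZero K] {D : ℤ} {α : K}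
    (hα : α ^ 2 = (D : K)) {αseq : ℕ → K} {a R Q : ℕ → ℚ} (h0 : αseq 0 = α)
    (hne : ∀ n, αseq n ≠ (a n : K)) (hstep : ∀ n, αseq (n + 1) = (αseq n - (a n : K))⁻¹)
    (hR0 : R 0 = 0) (hQ0 : Q 0 = 1) (hR : ∀ n, R (n + 1) = a n * Q n - R n)
    (hQ : ∀ n, Q (n + 1) = ((D : ℚ) - R (n + 1) ^ 2) / Q n) (hQne : ∀ n, Q n ≠ 0) (n : ℕ) :
    (Q n : K) * αseq n = α + (R n : K) := by
  induction n with
  | zero => simp [hR0, hQ0, h0]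
  | succ n ih =>
    have hs := sub_ne_zero.2 (hne n)
    have hQn : (Q n : K) ≠ 0 := by exact_mod_cast hQne n
    have hRK : (R (n + 1) : K) = a n * Q n - R n := by rw [hR]; push_cast; rfl
    have hQK : (Q (n + 1) : K) * Q n = D - (R (n + 1) : K) ^ 2 := by
      have : Q (n + 1) * Q n = D - R (n + 1) ^ 2 := by rw [hQ, div_mul_cancel₀ _ (hQne n)]
      exact_mod_cast congrArg (Rat.cast : ℚ → K) this
    rw [hstep, ← div_eq_mul_inv, div_eq_iff hs]
    apply mul_right_cancel₀ hQn
    linear_combination hQK - hα + (α + (R (n + 1) : K)) * (-ih - hRK)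

/-- Once `R m * Q m ≤ 0` and `D < R (m + 1) ^ 2`, the squares `R n ^ 2` increase strictly. -/
theorem strictMono_sq_of_mul_nonpos {D : ℚ} {a R Q : ℕ → ℚ} (ha : ∀ n, 0 ≤ a n)
    (hapos : ∀ n, 0 < a (n + 1)) (hR : ∀ n, R (n + 1) = a n * Q n - R n)
    (hQ : ∀ n, Q (n + 1) = (D - R (n + 1) ^ 2) / Q n) (hQne : ∀ n, Q n ≠ 0)
    {m : ℕ} (h1 : R m * Q m ≤ 0) (h2 : D < R (m + 1) ^ 2) :
    StrictMono fun i => R (m + 1 + i) ^ 2 := by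
  have hnext {n : ℕ} (hRQ : R n * Q n ≤ 0) (hDR : D < R (n + 1) ^ 2) :
      R (n + 1) * Q (n + 1) ≤ 0 ∧ R (n + 1) ^ 2 < R (n + 2) ^ 2 := by
    have hQn : 0 < Q n ^ 2 := by have := hQne n; positivity
    have hQQ : Q (n + 1) * Q n = D - R (n + 1) ^ 2 := by rw [hQ, div_mul_cancel₀ _ (hQne n)]
    have hnonneg : 0 ≤ R (n + 1) * Q n := by
      rw [hR]
      nlinarith [mul_nonneg (ha n) hQn.le]
    have hnonpos : R (n + 1) * Q (n + 1) ≤ 0 := by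
      refine nonpos_of_mul_nonpos_left (b := Q n ^ 2) ?_ hQn
      calc R (n + 1) * Q (n + 1) * Q n ^ 2 = R (n + 1) * Q n * (Q (n + 1) * Q n) := by ring
        _ ≤ 0 := mul_nonpos_of_nonneg_of_nonpos hnonneg (by linarith)
    refine ⟨hnonpos, ?_⟩
    have hsq : 0 < (a (n + 1) * Q (n + 1)) ^ 2 := by
      have := hQne (n + 1)
      have := hapos n
      positivity
    rw [hR (n + 1)]
    nlinarith [mul_nonneg (ha (n + 1)) (neg_nonneg.2 hnonpos)]
  have hinv (i : ℕ) : R (m + i) * Q (m + i) ≤ 0 ∧ D < R (m + i + 1) ^ 2 := by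
    induction i with
    | zero => exact ⟨h1, h2⟩
    | succ i ih => exact ⟨(hnext ih.1 ih.2).1, ih.2.trans (hnext ih.1 ih.2).2⟩
  refine strictMono_nat_of_lt_succ fun i => ?_
  have := (hnext (hinv i).1 (hinv i).2).2
  rwa [show m + 1 + i = m + i + 1 by ring, show m + 1 + (i + 1) = m + i + 2 by ring]

/-- **Proposition 2.** Let `α ∈ ℚ_p` with `α² = D`, `D` not a perfect square, with
complete quotients `αseq`, partial quotients `a`, and associated rationals `R`, `Q`.
If `R_m Q_m ≤ 0` and `R_{m+1}² > D` for some `m`, then the sequence of partial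
quotients is not ultimately periodic. -/
theorem ruban_sqrt_not_ultimately_periodic
    (p : ℕ) [Fact p.Prime] (D : ℤ) (hD : ¬ ∃ z : ℤ, z ^ 2 = D)
    (α : ℚ_[p]) (hα : α ^ 2 = (D : ℚ_[p]))
    (αseq : ℕ → ℚ_[p]) (a : ℕ → ℚ)
    (h0 : αseq 0 = α)
    (hfloor : ∀ n, a n ∈ Sp p ∧ ‖αseq n - (a n : ℚ_[p])‖ ≤ (p : ℝ)⁻¹)
    (hne : ∀ n, αseq n ≠ (a n : ℚ_[p]))
    (hstep : ∀ n, αseq (n + 1) = (αseq n - (a n : ℚ_[p]))⁻¹)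
    (R Q : ℕ → ℚ) (hR0 : R 0 = 0) (hQ0 : Q 0 = 1)
    (hR : ∀ n, R (n + 1) = a n * Q n - R n)
    (hQ : ∀ n, Q (n + 1) = ((D : ℚ) - R (n + 1) ^ 2) / Q n)
    (hQne : ∀ n, Q n ≠ 0)
    (m : ℕ) (h1 : R m * Q m ≤ 0) (h2 : (D : ℚ) < R (m + 1) ^ 2) :
    ¬ UltimatelyPeriodic a := by
  rintro ⟨k, l, hl, hper⟩
  have hp : (1 : ℝ) < p := by exact_mod_cast (Fact.out : p.Prime).one_lt
  have hapos (n : ℕ) : 0 < a (n + 1) := by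
    refine lt_of_le_of_ne (hfloor (n + 1)).1.2.1 fun h => ?_
    have hle := (hfloor (n + 1)).2
    rw [← h, Rat.cast_zero, sub_zero, hstep, norm_inv] at hle
    have hpos : 0 < ‖αseq n - (a n : ℚ_[p])‖ := norm_pos_iff.2 (sub_ne_zero.2 (hne n))
    have := (inv_le_inv₀ hpos (by linarith)).1 hle
    linarith [(hfloor n).2, inv_lt_one_of_one_lt₀ hp]
  set N := m + 1 + k with hN
  have hx : αseq N = αseq (N + l) := by
    have hshift (n : ℕ) : a (N + n + l) = a (N + n) := hper _ (by omega)
    refine Padic.eq_of_same_partial_quotients (x := fun n => αseq (N + n))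
      (y := fun n => αseq (N + n + l)) (b := fun n => (a (N + n) : ℚ_[p]))
      (fun n => (hfloor _).2) (fun n => ?_) (fun n => hne _) (fun n => ?_)
      (fun n => hstep _) (fun n => ?_)
    · simpa only [hshift] using (hfloor (N + n + l)).2
    · simpa only [hshift] using hne (N + n + l)
    · simpa only [hshift, add_right_comm _ l 1, ← add_assoc] using hstep (N + n + l)
  have hquot := mul_completeQuotient_eq hα h0 hne hstep hR0 hQ0 hR hQ hQne
  have hlin : α * ((Q (N + l) - Q N : ℚ) : ℚ_[p]) =
      ((R (N + l) * Q N - R N * Q (N + l) : ℚ) : ℚ_[p]) := by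
    have e1 := hquot N
    have e2 := hquot (N + l)
    rw [← hx] at e2
    push_cast
    linear_combination (Q N : ℚ_[p]) * e2 - (Q (N + l) : ℚ_[p]) * e1
  have hQeq : Q (N + l) = Q N := by
    by_contra h
    have h' : ((Q (N + l) - Q N : ℚ) : ℚ_[p]) ≠ 0 := by exact_mod_cast sub_ne_zero.2 h
    refine Padic.ne_ratCast_of_sq_eq_intCast hD hα
      ((R (N + l) * Q N - R N * Q (N + l)) / (Q (N + l) - Q N)) ?_
    rw [Rat.cast_div]
    exact eq_div_of_mul_eq h' hlin
  have hReq : R (N + l) = R N := by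
    have e1 := hquot N
    have e2 := hquot (N + l)
    rw [← hx, hQeq, e1] at e2
    exact_mod_cast (add_left_cancel e2).symm
  have hlt := strictMono_sq_of_mul_nonpos (fun n => (hfloor n).1.2.1) hapos hR hQ hQne h1 h2
    (show k < k + l by omega)
  simp only [← add_assoc, ← hN, hReq, lt_irrefl] at hlt
end

section
/- Let D be a negative integer that is not a perfect square and let α ∈ ℚ_p satisfy α² = D. Then the sequence (a_n) of partial quotients of the Ruban continued fraction expansion of α is not ultimately periodic: there are no integers k ≥ 0 and l ≥ 1 with a_{n+l} = a_n for all n ≥ k. In particular, the p-adic analogue of Lagrange's theorem fails for Ruban continued fractions. -/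
open Filter

/-- If `α² < 0` is rational, then `1` and `α` are linearly independent over `ℚ`. -/
lemma eq_zero_of_add_mul_eq_zero {K : Type*} [Field K] [CharZero K] {D : ℤ} (hD : D < 0) {α : K}
    (hα : α ^ 2 = (D : K)) {u v : ℚ} (h : (u : K) + v * α = 0) : u = 0 ∧ v = 0 := by
  have hK : ((u ^ 2 : ℚ) : K) = ((v ^ 2 * D : ℚ) : K) := by
    push_cast
    linear_combination ((u : K) - v * α) * h + (v : K) ^ 2 * hα
  have hQ : u ^ 2 = v ^ 2 * D := by exact_mod_cast hK
  have hD' : (D : ℚ) < 0 := by exact_mod_cast hD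
  have hv : v = 0 := by
    by_contra hv
    have : 0 < v ^ 2 := by positivity
    nlinarith [sq_nonneg u]
  subst hv
  refine ⟨?_, rfl⟩
  simpa using hQ

/-- If `α² < 0` is rational, then every complete quotient of a continued fraction of `α` with
rational partial quotients has the form `x + y α` with `x, y` rational and `y ≠ 0`. -/
lemma exists_completeQuotient_eq_add_mul {K : Type*} [Field K] [CharZero K] {D : ℤ} (hD : D < 0)
    {α : K} (hα : α ^ 2 = (D : K)) {s : ℕ → K} {a : ℕ → ℚ} (h0 : s 0 = α)
    (hstep : ∀ n, s (n + 1) = (s n - (a n : K))⁻¹) (n : ℕ) :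
    ∃ x y : ℚ, y ≠ 0 ∧ s n = (x : K) + y * α := by
  induction n with
  | zero => exact ⟨0, 1, one_ne_zero, by simp [h0]⟩
  | succ n ih =>
    obtain ⟨x, y, hy, hs⟩ := ih
    have hD' : (D : ℚ) < 0 := by exact_mod_cast hD
    have hN : (x - a n) ^ 2 - y ^ 2 * D ≠ 0 := by
      have : 0 < y ^ 2 := by positivity
      nlinarith [sq_nonneg (x - a n)]
    have hNK : ((x : K) - a n) ^ 2 - (y : K) ^ 2 * D ≠ 0 := by exact_mod_cast hN
    refine ⟨(x - a n) / ((x - a n) ^ 2 - y ^ 2 * D), -y / ((x - a n) ^ 2 - y ^ 2 * D),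
      div_ne_zero (neg_ne_zero.mpr hy) hN, ?_⟩
    rw [hstep, hs]
    apply inv_eq_of_mul_eq_one_right
    push_cast
    field_simp
    linear_combination -(y : K) ^ 2 * hα

/-- A complete quotient is a Möbius transform, with nonnegative rational coefficients, of any
later complete quotient, as long as the partial quotients in between are positive. -/
lemma exists_nonneg_moebius {K : Type*} [Field K] [CharZero K] {s : ℕ → K} {a : ℕ → ℚ}
    (hne : ∀ n, s n ≠ (a n : K)) (hstep : ∀ n, s (n + 1) = (s n - (a n : K))⁻¹)
    {k : ℕ} (ha : ∀ n, k ≤ n → 0 < a n) (m : ℕ) :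
    ∃ A B C E : ℚ, 0 ≤ A ∧ 0 ≤ B ∧ 0 ≤ C ∧ 0 ≤ E ∧ 0 < C + E ∧ (1 ≤ m → 0 < C) ∧
      s k * ((C : K) * s (k + m) + E) = (A : K) * s (k + m) + B := by
  induction m with
  | zero => exact ⟨1, 0, 0, 1, by simp⟩
  | succ m ih =>
    obtain ⟨A, B, C, E, hA, hB, hC, hE, hCE, -, h⟩ := ih
    have ham := ha (k + m) (by omega)
    have hpos : 0 < C * a (k + m) + E := by
      rcases hC.eq_or_lt with rfl | hC
      · simpa using hCE
      · positivity
    refine ⟨A * a (k + m) + B, A, C * a (k + m) + E, C, by positivity, hA, hpos.le, hC,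
      by positivity, fun _ => hpos, ?_⟩
    have hd : s (k + m) - a (k + m) ≠ 0 := sub_ne_zero.mpr (hne _)
    rw [← add_assoc, hstep]
    push_cast
    field_simp
    linear_combination h

/-- Complete quotients of a Ruban continued fraction, other than the first, have norm at least
`p`. -/
lemma le_norm_completeQuotient_succ {p : ℕ} [Fact p.Prime] {s : ℕ → ℚ_[p]} {a : ℕ → ℚ}
    (hfloor : ∀ n, ‖s n - (a n : ℚ_[p])‖ ≤ (p : ℝ)⁻¹) (hne : ∀ n, s n ≠ (a n : ℚ_[p]))
    (hstep : ∀ n, s (n + 1) = (s n - (a n : ℚ_[p]))⁻¹) (n : ℕ) : (p : ℝ) ≤ ‖s (n + 1)‖ := by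
  rw [hstep, norm_inv]
  exact le_inv_of_le_inv₀ (norm_pos_iff.mpr (sub_ne_zero.mpr (hne n))) (hfloor n)

/-- If the partial quotients of a Ruban continued fraction are periodic from some index on, so
are its complete quotients. -/
lemma completeQuotient_add_eq {p : ℕ} [Fact p.Prime] {s : ℕ → ℚ_[p]} {a : ℕ → ℚ}
    (hfloor : ∀ n, ‖s n - (a n : ℚ_[p])‖ ≤ (p : ℝ)⁻¹) (hne : ∀ n, s n ≠ (a n : ℚ_[p]))
    (hstep : ∀ n, s (n + 1) = (s n - (a n : ℚ_[p]))⁻¹) {k l : ℕ}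
    (hper : ∀ n, k ≤ n → a (n + l) = a n) {n : ℕ} (hn : k ≤ n) : s (n + l) = s n := by
  have hp : (1 : ℝ) < p := by exact_mod_cast (Fact.out : p.Prime).one_lt
  have hbound : ∀ m n, k ≤ n → ‖s (n + l) - s n‖ ≤ ((p : ℝ)⁻¹) ^ m := by
    intro m
    induction m with
    | zero =>
      intro n hn
      have h1 := hfloor (n + l)
      rw [hper n hn] at h1
      have h2 := Padic.nonarchimedean (s (n + l) - (a n : ℚ_[p])) (-(s n - (a n : ℚ_[p])))
      rw [norm_neg, show s (n + l) - (a n : ℚ_[p]) + -(s n - a n) = s (n + l) - s n by ring] at h2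
      have h3 : (p : ℝ)⁻¹ ≤ 1 := inv_le_one_of_one_le₀ hp.le
      rw [pow_zero]
      exact h2.trans (max_le (h1.trans h3) ((hfloor n).trans h3))
    | succ m ih =>
      intro n hn
      have e1 : s (n + l) = a n + (s (n + 1 + l))⁻¹ := by
        rw [show n + 1 + l = n + l + 1 by ring, hstep, inv_inv, hper n hn]
        ring
      have e2 : s n = a n + (s (n + 1))⁻¹ := by
        rw [hstep, inv_inv]
        ring
      have b1 : (p : ℝ) ≤ ‖s (n + 1 + l)‖ := by
        rw [show n + 1 + l = n + l + 1 by ring]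
        exact le_norm_completeQuotient_succ hfloor hne hstep _
      have b2 := le_norm_completeQuotient_succ hfloor hne hstep n
      have n1 : s (n + 1 + l) ≠ 0 := norm_pos_iff.mp (by linarith)
      have n2 : s (n + 1) ≠ 0 := norm_pos_iff.mp (by linarith)
      have e3 : s (n + l) - s n =
          -(s (n + 1 + l) - s (n + 1)) * (s (n + 1 + l))⁻¹ * (s (n + 1))⁻¹ := by
        rw [e1, e2]
        field_simp
        ring
      rw [e3, norm_mul, norm_mul, norm_neg, norm_inv, norm_inv, pow_succ]
      have c1 : ‖s (n + 1 + l)‖⁻¹ ≤ 1 := inv_le_one_of_one_le₀ (by linarith)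
      have c2 : ‖s (n + 1)‖⁻¹ ≤ (p : ℝ)⁻¹ := inv_anti₀ (by linarith) b2
      have c3 := ih (n + 1) (by omega)
      calc _ ≤ ((p : ℝ)⁻¹) ^ m * 1 * (p : ℝ)⁻¹ := by gcongr
        _ = _ := by ring
  have hlim := tendsto_pow_atTop_nhds_zero_of_lt_one (r := (p : ℝ)⁻¹) (by positivity)
    (inv_lt_one_of_one_lt₀ hp)
  have := ge_of_tendsto' hlim (fun m => hbound m n hn)
  exact sub_eq_zero.mp (norm_le_zero_iff.mp this)


/-- **Corollary 1.** If `D < 0` is an integer (in particular not a perfect square) and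
`α ∈ ℚ_p` satisfies `α² = D`, then the sequence of partial quotients of the Ruban
continued fraction expansion of `α` is not ultimately periodic. In particular, the
`p`-adic analogue of Lagrange's theorem fails for Ruban continued fractions. -/
theorem ruban_sqrt_neg_not_ultimately_periodic
    (p : ℕ) [Fact p.Prime] (D : ℤ) (hDneg : D < 0) (hD : ¬ ∃ z : ℤ, z ^ 2 = D)
    (α : ℚ_[p]) (hα : α ^ 2 = (D : ℚ_[p]))
    (αseq : ℕ → ℚ_[p]) (a : ℕ → ℚ)
    (h0 : αseq 0 = α)
    (hfloor : ∀ n, a n ∈ Sp p ∧ ‖αseq n - (a n : ℚ_[p])‖ ≤ (p : ℝ)⁻¹)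
    (hne : ∀ n, αseq n ≠ (a n : ℚ_[p]))
    (hstep : ∀ n, αseq (n + 1) = (αseq n - (a n : ℚ_[p]))⁻¹) :
    ¬ UltimatelyPeriodic a := by
  rintro ⟨k, l, hl, hper⟩
  have hf := fun n => (hfloor n).2
  have hp : (1 : ℝ) < p := by exact_mod_cast (Fact.out : p.Prime).one_lt
  have ha : ∀ n, k + 1 ≤ n → 0 < a n := by
    intro n hn
    obtain ⟨n, rfl⟩ : ∃ m, n = m + 1 := ⟨n - 1, by omega⟩
    refine (hfloor (n + 1)).1.2.1.lt_of_ne fun h => ?_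
    have h1 := hf (n + 1)
    have h2 := le_norm_completeQuotient_succ hf hne hstep n
    rw [← h, Rat.cast_zero, sub_zero] at h1
    have h3 := inv_lt_one_of_one_lt₀ hp
    linarith
  obtain ⟨A, B, C, E, -, hB, -, -, -, hC, h⟩ := exists_nonneg_moebius hne hstep ha l
  have hC := hC hl
  obtain ⟨x, y, hy, hs⟩ := exists_completeQuotient_eq_add_mul hDneg hα h0 hstep (k + 1)
  rw [completeQuotient_add_eq hf hne hstep hper (Nat.le_succ k), hs] at h
  have hlin : ((C * (x ^ 2 + y ^ 2 * D) + (E - A) * x - B : ℚ) : ℚ_[p]) +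
      ((y * (2 * C * x + (E - A)) : ℚ) : ℚ_[p]) * α = 0 := by
    push_cast
    linear_combination h - (C : ℚ_[p]) * (y : ℚ_[p]) ^ 2 * hα
  obtain ⟨hu, hv⟩ := eq_zero_of_add_mul_eq_zero hDneg hα hlin
  have hEA := (mul_eq_zero.mp hv).resolve_left hy
  have hB' : B = C * (y ^ 2 * D - x ^ 2) := by linear_combination -hu + x * hEA
  have hD' : (D : ℚ) < 0 := by exact_mod_cast hDneg
  have hneg : y ^ 2 * (D : ℚ) < 0 := mul_neg_of_pos_of_neg (by positivity) hD'
  have : C * (y ^ 2 * D - x ^ 2) < 0 :=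
    mul_neg_of_pos_of_neg hC (by linarith [sq_nonneg x])
  linarith
end

section
/- Let D be an integer that is not a perfect square and let α ∈ ℚ_p satisfy α² = D, with complete quotients (α_n) and partial quotients (a_n). Define rationals R_n, Q_n by R_0 = 0, Q_0 = 1, R_{n+1} = a_n·Q_n − R_n and Q_{n+1} = (D − R_{n+1}²)/Q_n. Then for every n ≥ 0, Q_n ≠ 0 and α_n = (R_n + α)/Q_n. -/
open Filter

/-- For `α ∈ ℚ_p` with `α² = D`, `D` not a perfect square, the complete quotients of the
Ruban continued fraction of `α` satisfy `α_n = (R_n + α) / Q_n`, where `R_0 = 0`,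
`Q_0 = 1`, `R_{n+1} = a_n Q_n - R_n`, `Q_{n+1} = (D - R_{n+1}²)/Q_n`; in particular
every `Q_n` is nonzero. -/
theorem ruban_sqrt_complete_quotients
    (p : ℕ) [Fact p.Prime] (D : ℤ) (hD : ¬ ∃ z : ℤ, z ^ 2 = D)
    (α : ℚ_[p]) (hα : α ^ 2 = (D : ℚ_[p]))
    (αseq : ℕ → ℚ_[p]) (a : ℕ → ℚ)
    (h0 : αseq 0 = α)
    (hfloor : ∀ n, a n ∈ Sp p ∧ ‖αseq n - (a n : ℚ_[p])‖ ≤ (p : ℝ)⁻¹)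
    (hne : ∀ n, αseq n ≠ (a n : ℚ_[p]))
    (hstep : ∀ n, αseq (n + 1) = (αseq n - (a n : ℚ_[p]))⁻¹)
    (R Q : ℕ → ℚ) (hR0 : R 0 = 0) (hQ0 : Q 0 = 1)
    (hR : ∀ n, R (n + 1) = a n * Q n - R n)
    (hQ : ∀ n, Q (n + 1) = ((D : ℚ) - R (n + 1) ^ 2) / Q n) :
    ∀ n : ℕ, Q n ≠ 0 ∧ αseq n = (((R n : ℚ) : ℚ_[p]) + α) / ((Q n : ℚ) : ℚ_[p]) := by
  have hsq : ∀ r : ℚ, (D : ℚ) - r ^ 2 ≠ 0 := by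
    intro r hr
    have h : IsSquare (D : ℚ) := ⟨r, by linarith [sq r]⟩
    obtain ⟨z, hz⟩ := Rat.isSquare_intCast_iff.mp h
    exact hD ⟨z, by rw [hz, sq]⟩
  intro n
  induction n with
  | zero => simp [h0, hR0, hQ0]
  | succ n ih =>
    obtain ⟨hQn, hαn⟩ := ih
    have hQn' : ((Q n : ℚ) : ℚ_[p]) ≠ 0 := by exact_mod_cast hQn
    have hnorm : ((D : ℚ_[p]) - ((R (n + 1) : ℚ) : ℚ_[p]) ^ 2) ≠ 0 := by
      exact_mod_cast hsq (R (n + 1))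
    have hfac : (α - ((R (n + 1) : ℚ) : ℚ_[p])) * (((R (n + 1) : ℚ) : ℚ_[p]) + α)
        = (D : ℚ_[p]) - ((R (n + 1) : ℚ) : ℚ_[p]) ^ 2 := by
      rw [← hα]; ring
    have hconj : α - ((R (n + 1) : ℚ) : ℚ_[p]) ≠ 0 := by
      intro h
      rw [h, zero_mul] at hfac
      exact hnorm hfac.symm
    have hdiff : αseq n - (a n : ℚ_[p])
        = (α - ((R (n + 1) : ℚ) : ℚ_[p])) / ((Q n : ℚ) : ℚ_[p]) := by
      rw [hαn, hR n]
      push_cast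
      field_simp
      ring
    have hQcast : ((Q (n + 1) : ℚ) : ℚ_[p])
        = ((D : ℚ_[p]) - ((R (n + 1) : ℚ) : ℚ_[p]) ^ 2) / ((Q n : ℚ) : ℚ_[p]) := by
      rw [hQ n]
      push_cast
      rfl
    refine ⟨by rw [hQ n]; exact div_ne_zero (hsq _) hQn, ?_⟩
    rw [hstep, hdiff, hQcast, inv_div, div_div_eq_mul_div, div_eq_div_iff hconj hnorm, ← hfac]
    ring
end

section
/- Let (a_i)_{i≥0} be a sequence with a_0 ∈ S_p and a_i ∈ S'_p for all i ≥ 1, with convergent denominators (q_n). Then for every n ≥ 1, |q_n|_p = |a_1·a_2·⋯·a_n|_p, i.e. |q_n|_p equals the product of |a_i|_p for i = 1, …, n. -/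
open Filter Polynomial

/-- `S'_p`: elements of `S_p` with `|b|_p ≥ p`. -/
def Sp' (p : ℕ) : Set ℚ :=
  {b : ℚ | b ∈ Sp p ∧ (p : ℚ) ≤ padicNorm p b}

/-- Denominators of the convergents, with shifted index: `rubanQ a 0 = q_{-1} = 0`,
`rubanQ a 1 = q_0 = 1`, and `rubanQ a (n+1) = q_n = a_n q_{n-1} + q_{n-2}`. -/
def rubanQ (a : ℕ → ℚ) : ℕ → ℚ
  | 0 => 0
  | 1 => 1
  | n + 2 => a (n + 1) * rubanQ a (n + 1) + rubanQ a n

/-- Numerators of the convergents, with shifted index: `rubanR a 0 = r_{-1} = 1`,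
`rubanR a 1 = r_0 = a_0`, and `rubanR a (n+1) = r_n = a_n r_{n-1} + r_{n-2}`. -/
def rubanR (a : ℕ → ℚ) : ℕ → ℚ
  | 0 => 1
  | 1 => a 0
  | n + 2 => a (n + 1) * rubanR a (n + 1) + rubanR a n

/-- `α` is the value of the infinite Ruban continued fraction `[a_0, a_1, …]`, i.e. the
limit in `ℚ_p` of the convergents `r_n / q_n`. -/
def IsRubanValue (p : ℕ) [Fact p.Prime] (a : ℕ → ℚ) (α : ℚ_[p]) : Prop :=
  Filter.Tendsto (fun n : ℕ => ((rubanR a (n + 1) / rubanQ a (n + 1) : ℚ) : ℚ_[p]))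
    Filter.atTop (nhds α)

theorem padicNorm_add_eq_left {p : ℕ} [Fact p.Prime] {x y : ℚ}
    (h : padicNorm p y < padicNorm p x) : padicNorm p (x + y) = padicNorm p x := by
  rw [padicNorm.add_eq_max_of_ne h.ne', max_eq_left h.le]

theorem padicNorm_rubanQ_lt_mul {p : ℕ} {a : ℕ → ℚ} [Fact p.Prime] {n : ℕ}
    (ha : a (n + 1) ∈ Sp' p) (h : padicNorm p (rubanQ a n) < padicNorm p (rubanQ a (n + 1))) :
    padicNorm p (rubanQ a (n + 1)) < padicNorm p (a (n + 1) * rubanQ a (n + 1)) := by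
  have hp : (1 : ℚ) < p := by exact_mod_cast (Fact.out : p.Prime).one_lt
  rw [padicNorm.mul]
  exact lt_mul_of_one_lt_left ((padicNorm.nonneg _).trans_lt h) (hp.trans_le ha.2)

theorem padicNorm_rubanQ_lt_succ {p : ℕ} [Fact p.Prime] {a : ℕ → ℚ}
    (ha : ∀ i, 1 ≤ i → a i ∈ Sp' p) (n : ℕ) :
    padicNorm p (rubanQ a n) < padicNorm p (rubanQ a (n + 1)) := by
  induction n with
  | zero => simp [rubanQ]
  | succ n ih =>
    have h := padicNorm_rubanQ_lt_mul (ha (n + 1) n.succ_pos) ih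
    rw [rubanQ, padicNorm_add_eq_left (ih.trans h)]
    exact h

theorem padicNorm_rubanQ_add_two {p : ℕ} [Fact p.Prime] {a : ℕ → ℚ}
    (ha : ∀ i, 1 ≤ i → a i ∈ Sp' p) (n : ℕ) :
    padicNorm p (rubanQ a (n + 2)) =
      padicNorm p (a (n + 1)) * padicNorm p (rubanQ a (n + 1)) := by
  have h := padicNorm_rubanQ_lt_succ ha n
  rw [rubanQ, padicNorm_add_eq_left
    (h.trans (padicNorm_rubanQ_lt_mul (ha (n + 1) n.succ_pos) h)), padicNorm.mul]

/-- **Lemma 1, (7).** `|q_n|_p = |a_1 a_2 ⋯ a_n|_p` for all `n ≥ 1`. -/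
theorem ruban_padicNorm_q
    (p : ℕ) [Fact p.Prime]
    (a : ℕ → ℚ) (ha0 : a 0 ∈ Sp p) (ha : ∀ i, 1 ≤ i → a i ∈ Sp' p)
    (n : ℕ) (hn : 1 ≤ n) :
    padicNorm p (rubanQ a (n + 1)) = ∏ i ∈ Finset.Icc 1 n, padicNorm p (a i) := by
  clear hn
  induction n with
  | zero => simp [rubanQ]
  | succ n ih =>
    rw [padicNorm_rubanQ_add_two ha, ih, Finset.prod_Icc_succ_top n.succ_pos, mul_comm]
end

section
/- Let (a_i)_{i≥0} be a sequence with a_0 ∈ S_p and a_i ∈ S'_p for all i ≥ 1, with convergent numerators (r_n). If a_0 ≠ 0, then |r_n|_p = |a_0·a_1·⋯·a_n|_p for all n ≥ 1. If a_0 = 0, then |r_1|_p = 1 and |r_n|_p = |a_2·a_3·⋯·a_n|_p for all n ≥ 2. -/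
open Filter Polynomial

theorem one_le_padicNorm_of_mem_Sp {p : ℕ} [hp : Fact p.Prime] {b : ℚ} (hb : b ∈ Sp p)
    (h0 : b ≠ 0) : 1 ≤ padicNorm p b := by
  obtain ⟨⟨k, z, hz⟩, hb0, hbp⟩ := hb
  by_contra! hlt
  have hpk : (p : ℚ) ^ k ≠ 0 := pow_ne_zero _ (Nat.cast_ne_zero.2 hp.out.ne_zero)
  have hdvd : ((p ^ k : ℕ) : ℤ) ∣ z := by
    rw [padicNorm.dvd_iff_norm_le, hz, padicNorm.mul, padicNorm.eq_zpow_of_nonzero hpk,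
      padicValRat.pow, padicValRat.self hp.out.one_lt, mul_one]
    exact mul_le_of_le_one_left (by positivity) hlt.le
  obtain ⟨w, rfl⟩ := hdvd
  obtain rfl : b = w := by
    push_cast at hz
    exact mul_right_cancel₀ hpk (by rw [← hz, mul_comm])
  have hw : (p : ℤ) ∣ w := (padicNorm.int_lt_one_iff w).1 hlt
  have hw0 : 0 < w := lt_of_le_of_ne (by exact_mod_cast hb0) (by exact_mod_cast h0.symm)
  have hwp : w < p := by exact_mod_cast hbp
  exact absurd (Int.le_of_dvd hw0 hw) hwp.not_ge

theorem one_lt_padicNorm_of_mem_Sp' {p : ℕ} [hp : Fact p.Prime] {b : ℚ} (hb : b ∈ Sp' p) :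
    1 < padicNorm p b :=
  lt_of_lt_of_le (by exact_mod_cast hp.out.one_lt) hb.2

theorem padicNorm_mul_add_of_le {p : ℕ} [Fact p.Prime] {c x y : ℚ} (hc : 1 < padicNorm p c)
    (hx : x ≠ 0) (hyx : padicNorm p y ≤ padicNorm p x) :
    padicNorm p (c * x + y) = padicNorm p c * padicNorm p x := by
  have hx' : 0 < padicNorm p x := (padicNorm.nonneg x).lt_of_ne' (padicNorm.nonzero hx)
  have hlt : padicNorm p y < padicNorm p (c * x) := by
    rw [padicNorm.mul]
    exact hyx.trans_lt (lt_mul_of_one_lt_left hx' hc)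
  rw [padicNorm.add_eq_max_of_ne hlt.ne', max_eq_left hlt.le, padicNorm.mul]

/-- If `u (n + 2) = c n * u (n + 1) + u n` with all `|c n|_p > 1`, and `|u 0|_p ≤ |u 1|_p`
with `u 1 ≠ 0`, then the leading terms determine the `p`-adic norms of `u`. -/
theorem padicNorm_eq_prod_of_recurrence {p : ℕ} [Fact p.Prime] {u c : ℕ → ℚ}
    (hu : ∀ n, u (n + 2) = c n * u (n + 1) + u n) (hc : ∀ n, 1 < padicNorm p (c n))
    (h1 : u 1 ≠ 0) (h01 : padicNorm p (u 0) ≤ padicNorm p (u 1)) (n : ℕ) :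
    padicNorm p (u (n + 1)) = padicNorm p (u 1) * ∏ i ∈ Finset.range n, padicNorm p (c i) := by
  have key : ∀ n, u (n + 1) ≠ 0 ∧ padicNorm p (u n) ≤ padicNorm p (u (n + 1)) := by
    intro n
    induction n with
    | zero => exact ⟨h1, h01⟩
    | succ n ih =>
      have hle : padicNorm p (u (n + 1)) ≤ padicNorm p (u (n + 2)) := by
        rw [hu, padicNorm_mul_add_of_le (hc n) ih.1 ih.2]
        exact le_mul_of_one_le_left (padicNorm.nonneg _) (hc n).le
      refine ⟨fun h => padicNorm.nonzero (p := p) ih.1 ?_, hle⟩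
      rw [h, padicNorm.zero] at hle
      exact le_antisymm hle (padicNorm.nonneg _)
  induction n with
  | zero => simp
  | succ n ih =>
    rw [hu, padicNorm_mul_add_of_le (hc n) (key n).1 (key n).2, ih, Finset.prod_range_succ]
    ring

/-- **Lemma 1, (8).** If `a_0 ≠ 0` then `|r_n|_p = |a_0 a_1 ⋯ a_n|_p` for `n ≥ 1`;
if `a_0 = 0` then `|r_1|_p = 1` and `|r_n|_p = |a_2 a_3 ⋯ a_n|_p` for `n ≥ 2`. -/
theorem ruban_padicNorm_r
    (p : ℕ) [Fact p.Prime]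
    (a : ℕ → ℚ) (ha0 : a 0 ∈ Sp p) (ha : ∀ i, 1 ≤ i → a i ∈ Sp' p) :
    (a 0 ≠ 0 → ∀ n, 1 ≤ n →
        padicNorm p (rubanR a (n + 1)) = ∏ i ∈ Finset.range (n + 1), padicNorm p (a i)) ∧
    (a 0 = 0 →
        padicNorm p (rubanR a 2) = 1 ∧
        ∀ n, 2 ≤ n →
          padicNorm p (rubanR a (n + 1)) = ∏ i ∈ Finset.Icc 2 n, padicNorm p (a i)) := by
  refine ⟨fun h0 n _ => ?_, fun h0 => ?_⟩
  · have h01 : padicNorm p (rubanR a 0) ≤ padicNorm p (rubanR a 1) := by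
      simpa [rubanR] using one_le_padicNorm_of_mem_Sp ha0 h0
    rw [padicNorm_eq_prod_of_recurrence (c := fun n => a (n + 1)) (fun _ => rfl)
      (fun n => one_lt_padicNorm_of_mem_Sp' (ha (n + 1) (by omega))) h0 h01,
      Finset.prod_range_succ', mul_comm]
    rfl
  · have key (n : ℕ) : padicNorm p (rubanR a (n + 2)) =
        ∏ i ∈ Finset.range n, padicNorm p (a (i + 2)) := by
      simpa [rubanR, h0] using padicNorm_eq_prod_of_recurrence (u := fun n => rubanR a (n + 1))
        (c := fun n => a (n + 2)) (fun _ => rfl)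
        (fun n => one_lt_padicNorm_of_mem_Sp' (ha (n + 2) (by omega)))
        (by simp [rubanR, h0]) (by simp [rubanR, h0]) n
    refine ⟨by simpa using key 0, fun n hn => ?_⟩
    obtain ⟨m, rfl⟩ := Nat.exists_eq_add_of_le' hn
    rw [key (m + 1), ← Finset.Ico_add_one_right_eq_Icc, Finset.prod_Ico_eq_prod_range,
      show m + 2 + 1 - 2 = m + 1 by omega]
    simp only [add_comm]
end

section
/- Let (a_i)_{i≥0} be a sequence with a_0 ∈ S_p and a_i ∈ S'_p for all i ≥ 1. Then q_n ≠ 0 for all n ≥ 0, and the sequence of convergents r_n/q_n, viewed as elements of ℚ_p, converges in ℚ_p; that is, every infinite Ruban continued fraction [a_0, a_1, a_2, …] has a well-defined value in ℚ_p. -/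
open Filter Polynomial

theorem rubanR_mul_rubanQ_sub (a : ℕ → ℚ) (n : ℕ) :
    rubanR a n * rubanQ a (n + 1) - rubanR a (n + 1) * rubanQ a n = (-1) ^ n := by
  induction n with
  | zero => simp [rubanR, rubanQ]
  | succ n ih =>
    rw [rubanR, rubanQ, pow_succ]
    linear_combination -ih

theorem mul_padicNorm_rubanQ_le (p : ℕ) [hp : Fact p.Prime] (a : ℕ → ℚ)
    (ha : ∀ i, 1 ≤ i → (p : ℚ) ≤ padicNorm p (a i)) (n : ℕ) :
    0 < padicNorm p (rubanQ a (n + 1)) ∧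
      p * padicNorm p (rubanQ a n) ≤ padicNorm p (rubanQ a (n + 1)) := by
  have hp1 : (1 : ℚ) < p := by exact_mod_cast hp.out.one_lt
  induction n with
  | zero => simp [rubanQ]
  | succ n ih =>
    obtain ⟨hpos, hle⟩ := ih
    have hmul : p * padicNorm p (rubanQ a (n + 1)) ≤
        padicNorm p (a (n + 1) * rubanQ a (n + 1)) := by
      rw [padicNorm.mul]
      exact mul_le_mul_of_nonneg_right (ha _ (by omega)) hpos.le
    have hn : 0 ≤ padicNorm p (rubanQ a n) := padicNorm.nonneg _
    have hlt : padicNorm p (rubanQ a n) < padicNorm p (a (n + 1) * rubanQ a (n + 1)) := by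
      nlinarith
    have heq : padicNorm p (rubanQ a (n + 2)) =
        padicNorm p (a (n + 1) * rubanQ a (n + 1)) := by
      rw [rubanQ, padicNorm.add_eq_max_of_ne hlt.ne', max_eq_left hlt.le]
    rw [heq]
    exact ⟨hn.trans_lt hlt, hmul⟩

theorem pow_le_padicNorm_rubanQ (p : ℕ) [Fact p.Prime] (a : ℕ → ℚ)
    (ha : ∀ i, 1 ≤ i → (p : ℚ) ≤ padicNorm p (a i)) (n : ℕ) :
    (p : ℚ) ^ n ≤ padicNorm p (rubanQ a (n + 1)) := by
  induction n with
  | zero => simp [rubanQ]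
  | succ n ih =>
    calc (p : ℚ) ^ (n + 1) = p * p ^ n := pow_succ' _ _
      _ ≤ p * padicNorm p (rubanQ a (n + 1)) := by gcongr
      _ ≤ _ := (mul_padicNorm_rubanQ_le p a ha (n + 1)).2

/-- Every infinite Ruban continued fraction has nonzero convergent denominators and a
well-defined value in `ℚ_p`: the convergents `r_n / q_n` converge in `ℚ_p`. -/
theorem ruban_value_exists
    (p : ℕ) [Fact p.Prime]
    (a : ℕ → ℚ) (ha0 : a 0 ∈ Sp p) (ha : ∀ i, 1 ≤ i → a i ∈ Sp' p) :
    (∀ n : ℕ, rubanQ a (n + 1) ≠ 0) ∧ ∃ α : ℚ_[p], IsRubanValue p a α := by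
  have ha' : ∀ i, 1 ≤ i → (p : ℚ) ≤ padicNorm p (a i) := fun i hi => (ha i hi).2
  have hp1 : (1 : ℚ) < p := by exact_mod_cast (Fact.out : p.Prime).one_lt
  have hq : ∀ n, rubanQ a (n + 1) ≠ 0 := fun n h => by
    simpa [h] using (mul_padicNorm_rubanQ_le p a ha' n).1
  refine ⟨hq, cauchySeq_tendsto_of_complete (cauchySeq_of_le_geometric (p : ℝ)⁻¹ 1
    (inv_lt_one_of_one_lt₀ (by exact_mod_cast hp1)) fun n => ?_)⟩
  have hdiff : rubanR a (n + 1) / rubanQ a (n + 1) - rubanR a (n + 2) / rubanQ a (n + 2) =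
      (-1) ^ (n + 1) / (rubanQ a (n + 1) * rubanQ a (n + 2)) := by
    rw [div_sub_div _ _ (hq n) (hq (n + 1)), ← rubanR_mul_rubanQ_sub a (n + 1)]
    ring
  have hsign : padicNorm p ((-1) ^ (n + 1)) = 1 := by
    rcases neg_one_pow_eq_or ℚ (n + 1) with h | h <;> simp [h]
  have hbound : padicNorm p (rubanR a (n + 1) / rubanQ a (n + 1) -
      rubanR a (n + 2) / rubanQ a (n + 2)) ≤ 1 * (p : ℚ)⁻¹ ^ n := by
    rw [hdiff, padicNorm.div, padicNorm.mul, hsign, one_mul, inv_pow, one_div]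
    refine inv_anti₀ (by positivity) ?_
    calc (p : ℚ) ^ n = p ^ n * 1 := (mul_one _).symm
      _ ≤ _ := mul_le_mul (pow_le_padicNorm_rubanQ p a ha' n)
        ((one_le_pow₀ hp1.le).trans (pow_le_padicNorm_rubanQ p a ha' (n + 1)))
        zero_le_one (padicNorm.nonneg _)
  rw [dist_eq_norm, ← Rat.cast_sub, Padic.eq_padicNorm]
  refine (Rat.cast_le.2 hbound).trans_eq ?_
  simp
end

section
/- Let h, k be positive integers and let (a_i)_{i≥0} be a sequence with a_0 = 0 and a_i ∈ S'_p for all i ≥ 1 which is ultimately periodic of the form a_{m+k} = a_m for all m ≥ h, and let η ∈ ℚ_p be the value of the infinite Ruban continued fraction [0, a_1, …, a_{h−1}, a_h, …, a_{h+k−1}, a_h, …, a_{h+k−1}, …]. Then η satisfies A·η² + B·η + C = 0 where A = q_{h−2}·q_{h+k−1} − q_{h−1}·q_{h+k−2}, B = q_{h−1}·r_{h+k−2} + r_{h−1}·q_{h+k−2} − r_{h−2}·q_{h+k−1} − q_{h−2}·r_{h+k−1}, and C = r_{h−2}·r_{h+k−1} − r_{h−1}·r_{h+k−2}; in particular, η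 is either rational or algebraic of degree exactly 2 over ℚ. -/
open Filter Polynomial

section Recurrence

variable {K : Type*} [NormedField K] [IsUltrametricDist K]

lemma norm_sub_le_max_norm (x y : K) : ‖x - y‖ ≤ max ‖x‖ ‖y‖ := by
  simpa [sub_eq_add_neg] using IsUltrametricDist.norm_add_le_max x (-y)

lemma norm_mul_add_eq_of_norm_le {c x y : K} (hc : 1 < ‖c‖) (hxy : ‖x‖ ≤ ‖y‖) :
    ‖c * y + x‖ = ‖c‖ * ‖y‖ := by
  rcases eq_or_ne y 0 with rfl | hy
  · have hx : x = 0 := by simpa using hxy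
    simp [hx]
  · have hlt : ‖x‖ < ‖c * y‖ := by
      rw [norm_mul]
      nlinarith [norm_pos_iff.mpr hy]
    rw [IsUltrametricDist.norm_add_eq_max_of_norm_ne_norm hlt.ne', max_eq_left hlt.le, norm_mul]

/-- Once a solution of the recurrence is nondecreasing in norm, its norm is multiplied by `‖c‖`
at every later step. -/
lemma norm_recurrence_growth {c x : ℕ → K} (hc : ∀ n, 1 < ‖c (n + 1)‖)
    (hx : ∀ n, x (n + 2) = c (n + 1) * x (n + 1) + x n) {n : ℕ} (hn : ‖x n‖ ≤ ‖x (n + 1)‖)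
    (m : ℕ) : ‖x (n + m)‖ ≤ ‖x (n + m + 1)‖ ∧
      ‖x (n + m + 2)‖ = ‖c (n + m + 1)‖ * ‖x (n + m + 1)‖ := by
  induction m with
  | zero => exact ⟨hn, by rw [add_zero, hx, norm_mul_add_eq_of_norm_le (hc n) hn]⟩
  | succ m ih =>
    have hle : ‖x (n + m + 1)‖ ≤ ‖x (n + m + 2)‖ := by
      rw [ih.2]
      exact le_mul_of_one_le_left (norm_nonneg _) (hc _).le
    refine ⟨hle, ?_⟩
    have := norm_mul_add_eq_of_norm_le (hc (n + m + 1)) hle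
    rwa [← hx (n + m + 1)] at this

/-- A solution of the recurrence which is negligible with respect to a dominant solution tends to
zero. -/
lemma tendsto_zero_of_recurrence {c x y : ℕ → K} {ρ : ℝ} (hρ : 1 < ρ)
    (hc : ∀ n, ρ ≤ ‖c (n + 1)‖)
    (hx : ∀ n, x (n + 2) = c (n + 1) * x (n + 1) + x n)
    (hy : ∀ n, y (n + 2) = c (n + 1) * y (n + 1) + y n)
    (hy0 : ‖y 0‖ ≤ ‖y 1‖) (hyne : ∀ n, y (n + 1) ≠ 0)
    (hlim : Tendsto (fun n => x (n + 1) / y (n + 1)) atTop (nhds 0)) :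
    Tendsto x atTop (nhds 0) := by
  have hc1 : ∀ n, 1 < ‖c (n + 1)‖ := fun n => hρ.trans_le (hc n)
  have hdecr : ∀ n, ‖x (n + 1)‖ ≤ ‖x n‖ := by
    intro n
    by_contra! hlt
    have hconst : ∀ m, ‖x (n + m + 1)‖ * ‖y (n + 1)‖ = ‖x (n + 1)‖ * ‖y (n + m + 1)‖ := by
      intro m
      induction m with
      | zero => rfl
      | succ m ih =>
        have h1 := (norm_recurrence_growth hc1 hx hlt.le m).2
        have h2 := (norm_recurrence_growth hc1 hy (by simpa using hy0) (n + m)).2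
        simp only [zero_add] at h2
        rw [← add_assoc n m 1, h1, h2]
        linear_combination ‖c (n + m + 1)‖ * ih
    have hpos : 0 < ‖x (n + 1)‖ / ‖y (n + 1)‖ :=
      div_pos ((norm_nonneg _).trans_lt hlt) (norm_pos_iff.mpr (hyne n))
    have hlim' : Tendsto (fun m => ‖x (m + n + 1) / y (m + n + 1)‖) atTop (nhds 0) := by
      simpa using ((tendsto_add_atTop_iff_nat n).mpr hlim).norm
    have heq : ∀ m, ‖x (m + n + 1) / y (m + n + 1)‖ = ‖x (n + 1)‖ / ‖y (n + 1)‖ := by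
      intro m
      rw [norm_div, add_comm m n, div_eq_div_iff (norm_ne_zero_iff.mpr (hyne _))
        (norm_ne_zero_iff.mpr (hyne _)), hconst m]
    simp only [heq] at hlim'
    exact hpos.ne' (tendsto_nhds_unique tendsto_const_nhds hlim')
  have hgeom : ∀ n, ‖x (n + 1)‖ ≤ ρ⁻¹ * ‖x n‖ := by
    intro n
    have h1 : c (n + 1) * x (n + 1) = x (n + 2) - x n := by rw [hx]; ring
    have h2 : ‖c (n + 1)‖ * ‖x (n + 1)‖ ≤ ‖x n‖ := by
      rw [← norm_mul, h1]
      exact (norm_sub_le_max_norm _ _).trans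
        (max_le ((hdecr _).trans (hdecr _)) le_rfl)
    rw [inv_mul_eq_div, le_div_iff₀ (by linarith), mul_comm]
    exact (mul_le_mul_of_nonneg_right (hc n) (norm_nonneg _)).trans h2
  have hbound : ∀ n, ‖x n‖ ≤ ρ⁻¹ ^ n * ‖x 0‖ := by
    intro n
    induction n with
    | zero => simp
    | succ n ih =>
      calc ‖x (n + 1)‖ ≤ ρ⁻¹ * ‖x n‖ := hgeom n
        _ ≤ ρ⁻¹ * (ρ⁻¹ ^ n * ‖x 0‖) := by gcongr
        _ = ρ⁻¹ ^ (n + 1) * ‖x 0‖ := by ring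
  refine squeeze_zero_norm hbound ?_
  simpa using (tendsto_pow_atTop_nhds_zero_of_lt_one (by positivity)
    (inv_lt_one_of_one_lt₀ hρ)).mul_const ‖x 0‖

/-- If the coefficients are `k`-periodic from `h + 1` on, a solution tending to zero has
proportional pairs of consecutive terms at `h` and `h + k`. -/
lemma cross_eq_of_periodic_of_tendsto_zero {c x : ℕ → K} {h k : ℕ}
    (hper : ∀ m, h + 1 ≤ m → c (m + k) = c m)
    (hx : ∀ n, x (n + 2) = c (n + 1) * x (n + 1) + x n)
    (hlim : Tendsto x atTop (nhds 0)) :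
    x h * x (h + 1 + k) - x (h + 1) * x (h + k) = 0 := by
  have hconst : ∀ m, ‖x (h + m) * x (h + m + 1 + k) - x (h + m + 1) * x (h + m + k)‖ =
      ‖x h * x (h + 1 + k) - x (h + 1) * x (h + k)‖ := by
    intro m
    induction m with
    | zero => simp
    | succ m ih =>
      rw [← ih, ← norm_neg]
      congr 1
      have h1 := hx (h + m)
      have h2 := hx (h + m + k)
      have h3 := hper (h + m + 1) (by omega)
      rw [show h + m + k + 2 = h + (m + 1) + 1 + k by ring,
        show h + m + k + 1 = h + m + 1 + k by ring, h3] at h2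
      rw [h2, show h + (m + 1) + 1 = h + m + 2 by ring, h1,
        show h + (m + 1) = h + m + 1 by ring]
      ring
  have ht : ∀ j, Tendsto (fun m => x (h + m + j)) atTop (nhds 0) := fun j => by
    simpa only [Function.comp_def, add_comm, add_left_comm] using
      hlim.comp (tendsto_add_atTop_nat (h + j))
  have hW := (((ht 0).mul (ht (1 + k))).sub ((ht 1).mul (ht k))).norm
  simp only [add_zero, ← add_assoc, hconst, mul_zero, sub_zero, norm_zero] at hW
  exact norm_eq_zero.mp (tendsto_nhds_unique tendsto_const_nhds hW)

end Recurrence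

section Ruban

variable {p : ℕ} [Fact p.Prime]

lemma prime_le_norm_of_mem_Sp' {b : ℚ} (hb : b ∈ Sp' p) : (p : ℝ) ≤ ‖(b : ℚ_[p])‖ := by
  rw [Padic.eq_padicNorm]
  exact_mod_cast hb.2

/-- An element of `S_p` is determined by its class modulo `pℤ_p`. -/
lemma eq_of_mem_Sp_of_norm_sub_le {b c : ℚ} (hb : b ∈ Sp p) (hc : c ∈ Sp p)
    (hbc : ‖(b : ℚ_[p]) - c‖ ≤ (p : ℝ)⁻¹) : b = c := by
  obtain ⟨⟨k, z, hz⟩, hb0, hbp⟩ := hb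
  obtain ⟨⟨l, w, hw⟩, hc0, hcp⟩ := hc
  have hp : 0 < (p : ℚ) := by exact_mod_cast (Fact.out : p.Prime).pos
  have hpR : 0 < (p : ℝ) := by exact_mod_cast hp
  set t : ℤ := z * p ^ l - w * p ^ k with ht
  have htq : (t : ℚ) = (b - c) * (p : ℚ) ^ (k + l) := by
    rw [ht]
    push_cast
    rw [hz, hw]
    ring
  have hdvd : (p : ℤ) ^ (k + l + 1) ∣ t := by
    have htp : (t : ℚ_[p]) = (b - c) * (p : ℚ_[p]) ^ (k + l) := by exact_mod_cast htq
    have := (Padic.norm_int_le_pow_iff_dvd (p := p) t (k + l + 1)).mp (by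
      rw [htp, norm_mul, norm_pow, Padic.norm_p, zpow_neg, zpow_natCast, pow_succ', mul_inv,
        inv_pow]
      gcongr)
    exact_mod_cast this
  have habs : |t| < (p : ℤ) ^ (k + l + 1) := by
    have : |(t : ℚ)| < (p : ℚ) ^ (k + l + 1) := by
      rw [htq, abs_mul, abs_of_pos (pow_pos hp (k + l)), pow_succ']
      gcongr
      rw [abs_lt]
      constructor <;> linarith
    exact_mod_cast this
  have ht0 : t = 0 := Int.eq_zero_of_abs_lt_dvd hdvd habs
  rw [ht0, Int.cast_zero, eq_comm, mul_eq_zero] at htq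
  exact sub_eq_zero.mp (htq.resolve_right (pow_ne_zero _ hp.ne'))

variable {a : ℕ → ℚ}

lemma norm_rubanQ_succ (ha : ∀ i, 1 ≤ i → a i ∈ Sp' p) (n : ℕ) :
    rubanQ a (n + 1) ≠ 0 ∧
      ‖(rubanQ a n : ℚ_[p])‖ ≤ (p : ℝ)⁻¹ * ‖(rubanQ a (n + 1) : ℚ_[p])‖ := by
  have hp : 1 < (p : ℝ) := by exact_mod_cast (Fact.out : p.Prime).one_lt
  induction n with
  | zero => simp [rubanQ]
  | succ n ih =>
    have hc := prime_le_norm_of_mem_Sp' (ha (n + 1) (by omega))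
    have hle : ‖(rubanQ a n : ℚ_[p])‖ ≤ ‖(rubanQ a (n + 1) : ℚ_[p])‖ :=
      ih.2.trans (mul_le_of_le_one_left (norm_nonneg _) (inv_le_one_of_one_le₀ hp.le))
    have hgrow : ‖(rubanQ a (n + 2) : ℚ_[p])‖ =
        ‖(a (n + 1) : ℚ_[p])‖ * ‖(rubanQ a (n + 1) : ℚ_[p])‖ := by
      rw [← norm_mul_add_eq_of_norm_le (hp.trans_le hc) hle, rubanQ]
      push_cast
      rfl
    have hpos : 0 < ‖(rubanQ a (n + 1) : ℚ_[p])‖ :=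
      norm_pos_iff.mpr (by exact_mod_cast ih.1)
    constructor
    · intro h0
      rw [show n + 1 + 1 = n + 2 from rfl] at h0
      rw [h0, Rat.cast_zero, norm_zero] at hgrow
      have : 0 < ‖(a (n + 1) : ℚ_[p])‖ * ‖(rubanQ a (n + 1) : ℚ_[p])‖ :=
        mul_pos (by linarith) hpos
      linarith
    · rw [hgrow, inv_mul_eq_div, le_div_iff₀ (by linarith), mul_comm]
      gcongr

/-- Uniqueness of finite Ruban continued fractions: the quotients `q_i / q_{i-1}` are distinct. -/
lemma rubanQ_cross_ne (ha : ∀ i, 1 ≤ i → a i ∈ Sp' p) (i d : ℕ) :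
    rubanQ a i * rubanQ a (i + d + 2) ≠ rubanQ a (i + 1) * rubanQ a (i + d + 1) := by
  induction i with
  | zero => simpa [rubanQ] using ((norm_rubanQ_succ ha d).1).symm
  | succ i ih =>
    intro heq
    set j := i + d + 1 with hj
    rw [show i + 1 + d + 2 = j + 2 by omega, show i + 1 + d + 1 = j + 1 by omega] at heq
    have hi : rubanQ a (i + 2) = a (i + 1) * rubanQ a (i + 1) + rubanQ a i := rfl
    have hj2 : rubanQ a (j + 2) = a (j + 1) * rubanQ a (j + 1) + rubanQ a j := rfl
    rw [show i + 1 + 1 = i + 2 from rfl, hi, hj2] at heq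
    obtain ⟨hi0, hin⟩ := norm_rubanQ_succ ha i
    obtain ⟨hj0, hjn⟩ := norm_rubanQ_succ ha j
    have hdiff : (a (j + 1) - a (i + 1)) * (rubanQ a (i + 1) * rubanQ a (j + 1)) =
        rubanQ a i * rubanQ a (j + 1) - rubanQ a (i + 1) * rubanQ a j := by
      linear_combination heq
    have hdiffp : ((a (j + 1) : ℚ_[p]) - a (i + 1)) * (rubanQ a (i + 1) * rubanQ a (j + 1)) =
        rubanQ a i * rubanQ a (j + 1) - rubanQ a (i + 1) * rubanQ a j := by
      exact_mod_cast hdiff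
    have hpos : 0 < ‖(rubanQ a (i + 1) * rubanQ a (j + 1) : ℚ_[p])‖ :=
      norm_pos_iff.mpr (by exact_mod_cast mul_ne_zero hi0 hj0)
    have hnorm : ‖(a (j + 1) : ℚ_[p]) - a (i + 1)‖ ≤ (p : ℝ)⁻¹ := by
      refine le_of_mul_le_mul_right ?_ hpos
      rw [← norm_mul, hdiffp, norm_mul]
      refine (norm_sub_le_max_norm _ _).trans (max_le ?_ ?_)
      · rw [norm_mul, ← mul_assoc]
        gcongr
      · rw [norm_mul, mul_left_comm]
        gcongr
    have hae := eq_of_mem_Sp_of_norm_sub_le (ha (j + 1) (by omega)).1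
      (ha (i + 1) (by omega)).1 hnorm
    rw [hae, sub_self, zero_mul] at hdiff
    exact ih (by rw [show i + d + 2 = j + 1 by omega]; linarith)

end Ruban

/-- A root of a quadratic over `F` lies in `F` or is of degree two. -/
lemma mem_range_or_natDegree_minpoly_eq_two {F L : Type*} [Field F] [Field L] [Algebra F L]
    {A B C : F} {x : L} (hA : A ≠ 0)
    (hx : algebraMap F L A * x ^ 2 + algebraMap F L B * x + algebraMap F L C = 0) :
    x ∈ (algebraMap F L).range ∨ (minpoly F x).natDegree = 2 := by
  set f : F[X] := Polynomial.C A * X ^ 2 + Polynomial.C B * X + Polynomial.C C with hf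
  have hdeg : f.natDegree = 2 := natDegree_quadratic hA
  have hf0 : f ≠ 0 := by
    rintro h0
    simp [h0] at hdeg
  have hroot : aeval x f = 0 := by simpa [hf] using hx
  have hint : IsIntegral F x := IsAlgebraic.isIntegral ⟨f, hf0, hroot⟩
  have hle := natDegree_le_of_dvd (minpoly.dvd F x hroot) hf0
  have hpos := minpoly.natDegree_pos hint
  by_cases h1 : (minpoly F x).natDegree = 1
  · exact Or.inl (minpoly.natDegree_eq_one_iff.mp h1)
  · right
    omega

/-- **Lemma 4, first part.** The value `η` of an ultimately periodic Ruban continued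
fraction `[0, a_1, …, a_{h-1}, \overline{a_h, …, a_{h+k-1}}]` satisfies
`A η² + B η + C = 0` with `A = q_{h-2} q_{h+k-1} - q_{h-1} q_{h+k-2}`,
`B = q_{h-1} r_{h+k-2} + r_{h-1} q_{h+k-2} - r_{h-2} q_{h+k-1} - q_{h-2} r_{h+k-1}`,
`C = r_{h-2} r_{h+k-1} - r_{h-1} r_{h+k-2}`; in particular `η` is rational or
algebraic of degree exactly 2 over `ℚ`. (Recall the index shift:
`q_m = rubanQ a (m+1)`, `r_m = rubanR a (m+1)`.) -/
theorem ruban_ultimately_periodic_quadratic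
    (p : ℕ) [Fact p.Prime]
    (a : ℕ → ℚ) (ha0 : a 0 = 0) (ha : ∀ i, 1 ≤ i → a i ∈ Sp' p)
    (h k : ℕ) (hh : 1 ≤ h) (hk : 1 ≤ k)
    (hper : ∀ m, h ≤ m → a (m + k) = a m)
    (η : ℚ_[p]) (hη : IsRubanValue p a η) :
    (((rubanQ a (h - 1) * rubanQ a (h + k) - rubanQ a h * rubanQ a (h + k - 1) : ℚ) : ℚ_[p])
        * η ^ 2 +
      ((rubanQ a h * rubanR a (h + k - 1) + rubanR a h * rubanQ a (h + k - 1)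
          - rubanR a (h - 1) * rubanQ a (h + k)
          - rubanQ a (h - 1) * rubanR a (h + k) : ℚ) : ℚ_[p]) * η +
      ((rubanR a (h - 1) * rubanR a (h + k) - rubanR a h * rubanR a (h + k - 1) : ℚ) : ℚ_[p])
        = 0) ∧
    ((∃ b : ℚ, (b : ℚ_[p]) = η) ∨ (minpoly ℚ η).natDegree = 2) := by
  obtain ⟨h, rfl⟩ : ∃ n, h = n + 1 := ⟨h - 1, by omega⟩
  obtain ⟨k, rfl⟩ : ∃ n, k = n + 1 := ⟨k - 1, by omega⟩
  have hp : 1 < (p : ℝ) := by exact_mod_cast (Fact.out : p.Prime).one_lt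
  have hQne : ∀ n, (rubanQ a (n + 1) : ℚ_[p]) ≠ 0 := fun n => by
    exact_mod_cast (norm_rubanQ_succ ha n).1
  have hQrec : ∀ n, (rubanQ a (n + 2) : ℚ_[p]) =
      a (n + 1) * rubanQ a (n + 1) + rubanQ a n := fun n => by
    simp [rubanQ]
  have hRrec : ∀ n, (rubanR a (n + 2) : ℚ_[p]) =
      a (n + 1) * rubanR a (n + 1) + rubanR a n := fun n => by
    simp [rubanR]
  let E : ℕ → ℚ_[p] := fun n => rubanQ a n * η - rubanR a n
  have hErec : ∀ n, E (n + 2) = a (n + 1) * E (n + 1) + E n := fun n => by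
    simp only [E, hQrec, hRrec]
    ring
  have hElim : Tendsto E atTop (nhds 0) := by
    refine tendsto_zero_of_recurrence (c := fun n => (a n : ℚ_[p]))
      (y := fun n => (rubanQ a n : ℚ_[p])) hp
      (fun n => prime_le_norm_of_mem_Sp' (ha (n + 1) (by omega))) hErec hQrec
      (by simp [rubanQ]) hQne ?_
    have hsub := (tendsto_const_nhds (x := η)).sub hη
    rw [sub_self] at hsub
    refine hsub.congr fun n => ?_
    have := hQne n
    simp only [E]
    push_cast
    field_simp
  have hcross := cross_eq_of_periodic_of_tendsto_zero (c := fun n => (a n : ℚ_[p]))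
    (k := k + 1) (fun m hm => congrArg _ (hper m hm)) hErec hElim
  rw [show h + 1 - 1 = h by omega, show h + 1 + (k + 1) - 1 = h + (k + 1) by omega]
  refine (and_iff_left_of_imp fun hquad => ?_).mpr ?_
  · have hA : rubanQ a h * rubanQ a (h + 1 + (k + 1)) -
        rubanQ a (h + 1) * rubanQ a (h + (k + 1)) ≠ 0 := by
      rw [show h + 1 + (k + 1) = h + k + 2 by ring, ← add_assoc]
      exact sub_ne_zero.mpr (rubanQ_cross_ne ha h k)
    exact mem_range_or_natDegree_minpoly_eq_two hA hquad
  · push_cast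
    linear_combination hcross
end

section
/- Let (a_i)_{i≥0} be a sequence with a_0 ∈ S_p and a_i ∈ S'_p for all i ≥ 1. Then q_n·|q_n|_p is an integer for every n ≥ 0, and if moreover a_0 = 0, then r_n·|r_n|_p is an integer for every n ≥ 0. -/
open Filter Polynomial

/-- Membership in `ℤ[1/p]` is preserved by `(a, x, y) ↦ a * x + y`. -/
theorem exists_int_eq_mul_add_mul_pow {p : ℕ} {a x y : ℚ}
    (ha : ∃ k : ℕ, ∃ z : ℤ, (z : ℚ) = a * (p : ℚ) ^ k)
    (hx : ∃ k : ℕ, ∃ z : ℤ, (z : ℚ) = x * (p : ℚ) ^ k)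
    (hy : ∃ k : ℕ, ∃ z : ℤ, (z : ℚ) = y * (p : ℚ) ^ k) :
    ∃ k : ℕ, ∃ z : ℤ, (z : ℚ) = (a * x + y) * (p : ℚ) ^ k := by
  obtain ⟨i, u, hu⟩ := ha
  obtain ⟨j, v, hv⟩ := hx
  obtain ⟨l, w, hw⟩ := hy
  refine ⟨i + j + l, u * v * (p : ℤ) ^ l + w * (p : ℤ) ^ (i + j), ?_⟩
  push_cast
  rw [hu, hv, hw]
  ring

theorem padicNorm_natCast_pow_self (p : ℕ) [Fact p.Prime] (k : ℕ) :
    padicNorm p ((p : ℚ) ^ k) = ((p : ℚ) ^ k)⁻¹ := by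
  induction k with
  | zero => simp
  | succ k ih => rw [pow_succ, padicNorm.mul, ih, padicNorm.padicNorm_p_of_prime, mul_inv]

theorem exists_int_eq_intCast_mul_padicNorm (p : ℕ) [Fact p.Prime] (z : ℤ) :
    ∃ m : ℤ, (m : ℚ) = z * padicNorm p z := by
  rcases eq_or_ne z 0 with rfl | hz
  · exact ⟨0, by simp⟩
  have hp : (p : ℚ) ≠ 0 := Nat.cast_ne_zero.mpr (Fact.out : p.Prime).ne_zero
  have hfin : FiniteMultiplicity (p : ℤ) z :=
    Int.finiteMultiplicity_iff.mpr ⟨by simpa using (Fact.out : p.Prime).ne_one, hz⟩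
  obtain ⟨m, hm, hdvd⟩ := hfin.exists_eq_pow_mul_and_not_dvd
  have hnorm : padicNorm p (m : ℚ) = 1 := padicNorm.int_eq_one_iff m |>.mpr hdvd
  refine ⟨m, ?_⟩
  rw [hm]
  push_cast
  rw [padicNorm.mul, hnorm, padicNorm_natCast_pow_self]
  field_simp

/-- An element `x` of `ℤ[1/p]` has integral prime-to-`p` part `x * |x|_p`. -/
theorem exists_int_eq_mul_padicNorm {p : ℕ} [Fact p.Prime] {x : ℚ}
    (hx : ∃ k : ℕ, ∃ z : ℤ, (z : ℚ) = x * (p : ℚ) ^ k) :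
    ∃ m : ℤ, (m : ℚ) = x * padicNorm p x := by
  obtain ⟨k, z, hz⟩ := hx
  have hp : (p : ℚ) ≠ 0 := Nat.cast_ne_zero.mpr (Fact.out : p.Prime).ne_zero
  obtain ⟨m, hm⟩ := exists_int_eq_intCast_mul_padicNorm p z
  refine ⟨m, ?_⟩
  rw [hm, hz, padicNorm.mul, padicNorm_natCast_pow_self]
  field_simp

theorem exists_int_eq_rubanQ_mul_pow {p : ℕ} {a : ℕ → ℚ} (ha : ∀ i, 1 ≤ i → a i ∈ Sp p) :
    ∀ n, ∃ k : ℕ, ∃ z : ℤ, (z : ℚ) = rubanQ a n * (p : ℚ) ^ k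
  | 0 => ⟨0, 0, by simp [rubanQ]⟩
  | 1 => ⟨0, 1, by simp [rubanQ]⟩
  | n + 2 => exists_int_eq_mul_add_mul_pow (ha (n + 1) n.succ_pos).1
      (exists_int_eq_rubanQ_mul_pow ha (n + 1)) (exists_int_eq_rubanQ_mul_pow ha n)

theorem exists_int_eq_rubanR_mul_pow {p : ℕ} {a : ℕ → ℚ} (ha : ∀ i, a i ∈ Sp p) :
    ∀ n, ∃ k : ℕ, ∃ z : ℤ, (z : ℚ) = rubanR a n * (p : ℚ) ^ k
  | 0 => ⟨0, 1, by simp [rubanR]⟩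
  | 1 => (ha 0).1
  | n + 2 => exists_int_eq_mul_add_mul_pow (ha (n + 1)).1
      (exists_int_eq_rubanR_mul_pow ha (n + 1)) (exists_int_eq_rubanR_mul_pow ha n)

/-- For all `n ≥ 0`, `q_n |q_n|_p` is an integer, and if `a_0 = 0` then `r_n |r_n|_p`
is an integer as well. (Recall the index shift: `q_n = rubanQ a (n+1)`.) -/
theorem ruban_q_mul_padicNorm_int
    (p : ℕ) [Fact p.Prime]
    (a : ℕ → ℚ) (ha0 : a 0 ∈ Sp p) (ha : ∀ i, 1 ≤ i → a i ∈ Sp' p) :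
    (∀ n : ℕ, ∃ z : ℤ, (z : ℚ) = rubanQ a (n + 1) * padicNorm p (rubanQ a (n + 1))) ∧
    (a 0 = 0 →
      ∀ n : ℕ, ∃ z : ℤ, (z : ℚ) = rubanR a (n + 1) * padicNorm p (rubanR a (n + 1))) := by
  refine ⟨fun n => exists_int_eq_mul_padicNorm
    (exists_int_eq_rubanQ_mul_pow (fun i hi => (ha i hi).1) (n + 1)), fun _ n =>
    exists_int_eq_mul_padicNorm (exists_int_eq_rubanR_mul_pow (fun i => ?_) (n + 1))⟩
  rcases i.eq_zero_or_pos with rfl | hi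
  · exact ha0
  · exact (ha i hi).1
end
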